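/- Let f(k) = 3^{k+1} − 2 and let T : X → X be the moving-head action of the SMART machine. For every k ≥ 0, every s_* ∈ {0,1,2} and every s_+ ∈ {1,2}, the following four moves hold. (M_▶) If x ∈ X satisfies x₀ = (▶₂, s_+), x_i = 0 for 1 ≤ i ≤ k, and x_{k+1} = s_*, then T^{f(k)}(x) agrees with x at every position outside {0, k+1}, with T^{f(k)}(x)₀ = s_+ and T^{f(k)}(x)_{k+1} = (▶₁, s_*); moreover for 0 ≤ t < f(k) the head position of T^t(x) lies in [0,k], and for every 0 ≤ t ≤ f(k) the tape letter of T^t(x) at position 0 equals s_+. (M_◀) If x₀ = s_*, x_i = 0 for 1 ≤ i ≤ k, and x_{k+1} = (◀₂, s_+), then T^{f(k)}(x) agrees with x outside {0, k+1}, with T^{f(k)}(x)₀ = (◀₁, s_*) and T^{f(k)}(x)_{k+1} = s_+; moreover for 0 ≤ t < f(k) the head position of T^t(x) lies in [1,k+1], and for every 0 ≤ t ≤ f(k) the tape letter of T^t(x) at position k+1 equals s_+. (M_▷) If x₀ = (▷₂, s_*), x_i = 0 for 1 ≤ i ≤ k, and x_{k+1} = s_+, then T^{f(k)}(x) agrees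 with x outside {0, k+1}, with T^{f(k)}(x)₀ = s_* and T^{f(k)}(x)_{k+1} = (▷₁, s_+); moreover for 1 ≤ t ≤ f(k) the head position of T^t(x) lies in [1,k+1], and for every 0 ≤ t ≤ f(k) the tape letter of T^t(x) at position k+1 equals s_+. (M_◁) If x₀ = s_+, x_i = 0 for 1 ≤ i ≤ k, and x_{k+1} = (◁₂, s_*), then T^{f(k)}(x) agrees with x outside {0, k+1}, with T^{f(k)}(x)₀ = (◁₁, s_+) and T^{f(k)}(x)_{k+1} = s_*; moreover for 1 ≤ t ≤ f(k) the head position of T^t(x) lies in [0,k], and for every 0 ≤ t ≤ f(k) the tape letter of T^t(x) at position 0 equals s_+. -/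

import Mathlib

/-! ### Turing machine symbols and local step functions -/

/-- Tape/head symbols: a plain tape letter, or a head `(q, a)` on top of letter `a`. -/
abbrev TSym (Q Γ : Type) : Type := Γ ⊕ (Q × Γ)

/-- The tape letter carried by a cell (under the head if the cell carries the head). -/
def tapeLetter {Q Γ : Type} : TSym Q Γ → Γ
  | Sum.inl a => a
  | Sum.inr (_, a) => a

/-- A complete deterministic machine is given by a head-step function: at `(q, a)` it either
rewrites the head in place (`.inl (q', b)`, a matching transition), or moves in direction
`δ ∈ {+1, -1}` into state `q'` (`.inr (δ, q')`, a move transition). -/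
abbrev HeadStep (Q Γ : Type) : Type := Q → Γ → ((Q × Γ) ⊕ (ℤ × Q))

/-- If the symbol `s` carries a head about to move in direction `d`, the state in which the
head arrives; `none` otherwise. -/
def arrivesAs {Q Γ : Type} (δ : HeadStep Q Γ) (s : TSym Q Γ) (d : ℤ) : Option Q :=
  match s with
  | Sum.inl _ => none
  | Sum.inr (q, a) =>
    match δ q a with
    | Sum.inl _ => none
    | Sum.inr (d', q') => if d' = d then some q' else none

/-- The local rule of the moving-head dynamics: the new symbol of a cell, given the symbols
`l, c, r` of its left neighbour, itself, and its right neighbour. -/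
def localStep {Q Γ : Type} (δ : HeadStep Q Γ) (l c r : TSym Q Γ) : TSym Q Γ :=
  match c with
  | Sum.inr (q, a) =>
    (match δ q a with
     | Sum.inl qb => Sum.inr qb
     | Sum.inr _ => Sum.inl a)
  | Sum.inl a =>
    (match arrivesAs δ l 1 with
     | some q' => Sum.inr (q', a)
     | none =>
       match arrivesAs δ r (-1) with
       | some q' => Sum.inr (q', a)
       | none => Sum.inl a)

/-- The moving-head action of a complete deterministic machine on bi-infinite tapes. -/
def stepZ {Q Γ : Type} (δ : HeadStep Q Γ) (x : ℤ → TSym Q Γ) : ℤ → TSym Q Γ :=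
  fun i => localStep δ (x (i - 1)) (x i) (x (i + 1))

/-- The action of a complete deterministic machine on cyclic tapes of length `ℓ`. -/
def stepC {Q Γ : Type} (δ : HeadStep Q Γ) (ℓ : ℕ) (w : ZMod ℓ → TSym Q Γ) :
    ZMod ℓ → TSym Q Γ :=
  fun i => localStep δ (w (i - 1)) (w i) (w (i + 1))

/-- A configuration has at most one head. -/
def AtMostOneHeadZ {Q Γ : Type} (x : ℤ → TSym Q Γ) : Prop :=
  ∀ i j : ℤ, (x i).isRight = true → (x j).isRight = true → i = j

/-- A cyclic configuration has at most one head. -/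
def AtMostOneHeadC {Q Γ : Type} {ℓ : ℕ} (w : ZMod ℓ → TSym Q Γ) : Prop :=
  ∀ i j : ZMod ℓ, (w i).isRight = true → (w j).isRight = true → i = j

/-! ### The SMART machine -/

/-- The four arrows `▶, ◀, ▷, ◁` (filled right/left, hollow right/left). -/
inductive Arrow : Type
  | rf  -- ▶ (filled right)
  | lf  -- ◀ (filled left)
  | rh  -- ▷ (hollow right)
  | lh  -- ◁ (hollow left)
deriving DecidableEq

/-- The SMART state set `Q̊`: an arrow with a subscript in `{1,2}`; the subscript `b`
is represented by the `Fin 2` value `b - 1`. -/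
abbrev SQ : Type := Arrow × Fin 2

/-- The SMART tape alphabet `{0,1,2}`. -/
abbrev Letter : Type := Fin 3

/-- The head-step function of the SMART machine.  States `q₂` (second component `1`) are
move states; states `q₁` (second component `0`) are matching states. -/
def smartStep : HeadStep SQ Letter := fun q a =>
  if q.2 = 1 then
    match q.1 with
    | .rf => Sum.inr (1, (.rf, 0))   -- (▶₂, +1, ▶₁)
    | .lf => Sum.inr (-1, (.lf, 0))  -- (◀₂, −1, ◀₁)
    | .rh => Sum.inr (1, (.rh, 0))   -- (▷₂, +1, ▷₁)
    | .lh => Sum.inr (-1, (.lh, 0))  -- (◁₂, −1, ◁₁)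
  else
    match q.1 with
    | .rf => Sum.inl (if a = 0 then ((.lf, 1), 1) else if a = 1 then ((.lh, 1), 1) else ((.lh, 1), 2))
    | .lf => Sum.inl (if a = 0 then ((.rf, 1), 1) else if a = 1 then ((.rh, 1), 1) else ((.rh, 1), 2))
    | .rh => Sum.inl (if a = 0 then ((.rf, 1), 2) else if a = 1 then ((.rf, 1), 0) else ((.lh, 1), 0))
    | .lh => Sum.inl (if a = 0 then ((.lf, 1), 2) else if a = 1 then ((.lf, 1), 0) else ((.rh, 1), 0))

/-- `f(k) = 3^(k+1) - 2`, the duration of the basic SMART moves. -/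
def smartTime (k : ℕ) : ℕ := 3 ^ (k + 1) - 2

/-- A configuration with exactly one head: its state, its position, and the tape contents. -/
structure HeadConf : Type where
  /-- The state of the head. -/
  state : SQ
  /-- The position of the head. -/
  pos : ℤ
  /-- The tape letters. -/
  tape : ℤ → Letter

namespace HeadConf

/-- The bi-infinite word described by a one-head configuration. -/
def toWord (c : HeadConf) : ℤ → TSym SQ Letter :=
  fun i => if i = c.pos then Sum.inr (c.state, c.tape i) else Sum.inl (c.tape i)

/-- One step of the SMART machine on one-head configurations. -/
def step (c : HeadConf) : HeadConf :=
  match smartStep c.state (c.tape c.pos) with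
  | Sum.inl (q, b) => ⟨q, c.pos, Function.update c.tape c.pos b⟩
  | Sum.inr (e, q) => ⟨q, c.pos + e, c.tape⟩

lemma smartStep_eq_inr {q q' : SQ} {a : Letter} {e : ℤ}
    (h : smartStep q a = Sum.inr (e, q')) : e = 1 ∨ e = -1 := by
  obtain ⟨r, b⟩ := q
  unfold smartStep at h
  cases r <;> by_cases hb : b = 1 <;> simp [hb] at h <;> omega

lemma stepZ_toWord (c : HeadConf) : stepZ smartStep c.toWord = c.step.toWord := by
  funext i
  obtain ⟨q, p, u⟩ := c
  rcases h : smartStep q (u p) with ⟨q', b⟩ | ⟨e, q'⟩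
  · by_cases h0 : i = p
    · subst h0
      simp [stepZ, toWord, step, localStep, h]
    · by_cases h1 : i - 1 = p <;> by_cases h2 : i + 1 = p <;>
        simp [stepZ, toWord, step, localStep, arrivesAs, h, h0, h1, h2]
  · by_cases h0 : i = p
    · subst h0
      rcases smartStep_eq_inr h with rfl | rfl <;>
        simp [stepZ, toWord, step, localStep, h]
    · rcases smartStep_eq_inr h with rfl | rfl
      · by_cases h1 : i = p + 1
        · subst h1
          simp [stepZ, toWord, step, localStep, arrivesAs, h]
        · have h1' : i - 1 ≠ p := by omega
          by_cases h2 : i + 1 = p <;>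
            simp [stepZ, toWord, step, localStep, arrivesAs, h, h0, h1, h1', h2]
      · by_cases h1 : i = p + -1
        · subst h1
          have h2 : p + -1 - 1 ≠ p := by omega
          simp [stepZ, toWord, step, localStep, arrivesAs, h, h2]
        · have h1' : i + 1 ≠ p := by omega
          by_cases h2 : i - 1 = p <;>
            simp [stepZ, toWord, step, localStep, arrivesAs, h, h0, h1, h1', h2]

lemma iterate_stepZ_toWord (n : ℕ) (c : HeadConf) :
    (stepZ smartStep)^[n] c.toWord = (step^[n] c).toWord :=
  ((show Function.Semiconj toWord step (stepZ smartStep) from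
    fun c => (stepZ_toWord c).symm).iterate_right n c).symm

lemma eq_toWord {x : ℤ → TSym SQ Letter} (hx : AtMostOneHeadZ x) {p : ℤ} {q : SQ} {a : Letter}
    (hp : x p = Sum.inr (q, a)) : x = toWord ⟨q, p, fun i => tapeLetter (x i)⟩ := by
  funext i
  by_cases h : i = p
  · subst h
    simp [toWord, hp, tapeLetter]
  · rcases hi : x i with b | b
    · simp [toWord, h, hi, tapeLetter]
    · exact absurd (hx i p (by simp [hi]) (by simp [hp])) h

lemma isRight_toWord {c : HeadConf} {i : ℤ} : (c.toWord i).isRight = true ↔ i = c.pos := by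
  by_cases h : i = c.pos <;> simp [toWord, h]

lemma tapeLetter_toWord (c : HeadConf) (i : ℤ) : tapeLetter (c.toWord i) = c.tape i := by
  by_cases h : i = c.pos <;> simp [toWord, h, tapeLetter]

/-- The filled arrow pointing in direction `d = ±1`. -/
def filled (d : ℤ) (b : Fin 2) : SQ := (if d = 1 then .rf else .lf, b)

/-- The hollow arrow pointing in direction `d = ±1`. -/
def hollow (d : ℤ) (b : Fin 2) : SQ := (if d = 1 then .rh else .lh, b)

lemma step_filled_move {d : ℤ} (hd : d = 1 ∨ d = -1) (p : ℤ) (u : ℤ → Letter) :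
    step ⟨filled d 1, p, u⟩ = ⟨filled d 0, p + d, u⟩ := by
  rcases hd with rfl | rfl <;> simp [step, filled, smartStep]

lemma step_hollow_move {d : ℤ} (hd : d = 1 ∨ d = -1) (p : ℤ) (u : ℤ → Letter) :
    step ⟨hollow d 1, p, u⟩ = ⟨hollow d 0, p + d, u⟩ := by
  rcases hd with rfl | rfl <;> simp [step, hollow, smartStep]

lemma step_filled_zero {d p : ℤ} {u : ℤ → Letter} (hd : d = 1 ∨ d = -1) (h : u p = 0) :
    step ⟨filled d 0, p, u⟩ = ⟨filled (-d) 1, p, Function.update u p 1⟩ := by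
  rcases hd with rfl | rfl <;> simp [step, filled, smartStep, h]

lemma step_filled_ne_zero {d p : ℤ} {u : ℤ → Letter} (hd : d = 1 ∨ d = -1) (h : u p ≠ 0) :
    step ⟨filled d 0, p, u⟩ = ⟨hollow (-d) 1, p, u⟩ := by
  have h' : u p = 1 ∨ u p = 2 := by
    generalize u p = s at h
    decide +revert
  rcases hd with rfl | rfl <;> rcases h' with h' | h' <;>
    simp [step, filled, hollow, smartStep, h', Function.update_eq_self_iff]

lemma step_hollow_zero {d p : ℤ} {u : ℤ → Letter} (hd : d = 1 ∨ d = -1) (h : u p = 0) :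
    step ⟨hollow d 0, p, u⟩ = ⟨filled d 1, p, Function.update u p 2⟩ := by
  rcases hd with rfl | rfl <;> simp [step, filled, hollow, smartStep, h]

lemma step_hollow_one {d p : ℤ} {u : ℤ → Letter} (hd : d = 1 ∨ d = -1) (h : u p = 1) :
    step ⟨hollow d 0, p, u⟩ = ⟨filled d 1, p, Function.update u p 0⟩ := by
  rcases hd with rfl | rfl <;> simp [step, filled, hollow, smartStep, h]

lemma step_hollow_two {d p : ℤ} {u : ℤ → Letter} (hd : d = 1 ∨ d = -1) (h : u p = 2) :
    step ⟨hollow d 0, p, u⟩ = ⟨hollow (-d) 1, p, Function.update u p 0⟩ := by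
  rcases hd with rfl | rfl <;> simp [step, hollow, smartStep, h]

/-- The machine goes from `c` to `c'` in `n` steps, all configurations before the last one
satisfying `P`. -/
def Run (P : HeadConf → Prop) (n : ℕ) (c c' : HeadConf) : Prop :=
  step^[n] c = c' ∧ ∀ t < n, P (step^[t] c)

namespace Run

variable {P P' : HeadConf → Prop} {n m : ℕ} {c c' c'' : HeadConf}

lemma refl : Run P 0 c c := ⟨rfl, by simp⟩

lemma head (h : step c = c') (hc : P c) (hr : Run P n c' c'') : Run P (n + 1) c c'' := by
  subst h
  refine ⟨hr.1, fun t ht => ?_⟩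
  cases t with
  | zero => exact hc
  | succ t => exact hr.2 t (by omega)

lemma trans (h : Run P n c c') (h' : Run P m c' c'') : Run P (m + n) c c'' := by
  refine ⟨by rw [Function.iterate_add_apply, h.1, h'.1], fun t ht => ?_⟩
  rcases lt_or_ge t n with htn | htn
  · exact h.2 t htn
  · obtain ⟨s, rfl⟩ := Nat.exists_eq_add_of_le' htn
    rw [Function.iterate_add_apply, h.1]
    exact h'.2 s (by omega)

lemma mono (h : Run P n c c') (hP : ∀ c, P c → P' c) : Run P' n c c' :=
  ⟨h.1, fun t ht => hP _ (h.2 t ht)⟩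

lemma of_le (h : Run P n c c') (hc : P c') {t : ℕ} (ht : t ≤ n) : P (step^[t] c) := by
  rcases ht.lt_or_eq with ht | rfl
  · exact h.2 t ht
  · rwa [h.1]

end Run

/-- Seen from `a` in direction `d`, the head lies between distances `lo` and `hi`, and the tape
agrees with `u` except possibly at distances between `1` and `k`. -/
def Inside (d a lo hi : ℤ) (k : ℕ) (u : ℤ → Letter) (c : HeadConf) : Prop :=
  (lo ≤ d * (c.pos - a) ∧ d * (c.pos - a) ≤ hi) ∧
    ∀ i, d * (i - a) ≤ 0 ∨ k + 1 ≤ d * (i - a) → c.tape i = u i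

/-- The time of a basic move, not counting one of its moving steps. -/
def innerTime : ℕ → ℕ
  | 0 => 0
  | k + 1 => 3 * innerTime k + 6

lemma smartTime_eq (k : ℕ) : smartTime k = innerTime k + 1 := by
  have h : ∀ k, innerTime k + 3 = 3 ^ (k + 1) := by
    intro k
    induction k with
    | zero => rfl
    | succ k ih => rw [pow_succ, ← ih, innerTime]; ring
  have := h k
  unfold smartTime
  omega

/-- The basic moves of size `k` with filled arrows. -/
def FilledMove (k : ℕ) : Prop :=
  ∀ (d a : ℤ) (u : ℤ → Letter), (d = 1 ∨ d = -1) → u a ≠ 0 →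
    (∀ i, 1 ≤ d * (i - a) → d * (i - a) ≤ k → u i = 0) →
    Run (Inside d a 0 k k u) (innerTime k + 1)
      ⟨filled d 1, a, u⟩ ⟨filled d 0, a + d * (k + 1), u⟩

/-- The basic moves of size `k` with hollow arrows, after their first step. -/
def HollowMove (k : ℕ) : Prop :=
  ∀ (d a : ℤ) (u : ℤ → Letter), (d = 1 ∨ d = -1) → u (a + d * (k + 1)) ≠ 0 →
    (∀ i, 1 ≤ d * (i - a) → d * (i - a) ≤ k → u i = 0) →
    Run (Inside d a 1 (k + 1) k u) (innerTime k)
      ⟨hollow d 0, a + d, u⟩ ⟨hollow d 0, a + d * (k + 1), u⟩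

lemma filledMove_succ {k : ℕ} (hF : FilledMove k) (hH : HollowMove k) : FilledMove (k + 1) := by
  intro d a u hd ha hu
  have hd' : -d = 1 ∨ -d = -1 := by omega
  set b : ℤ := a + d * (k + 1) with hb
  set v : ℤ → Letter := Function.update u b 1 with hv
  have hub : u b = 0 := by
    apply hu <;> rcases hd with rfl | rfl <;> simp [hb]
  have hba : b ≠ a := by rcases hd with rfl | rfl <;> omega
  have hva : v a = u a := by simp [hv, hba.symm]
  have hvb : v b = 1 := by simp [hv]
  have hvu : Function.update v b 0 = u := by simp [hv, ← hub]
  have hvi : ∀ i, i ≠ b → v i = u i := fun i hi => by simp [hv, hi]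
  have r1 := (hF d a u hd ha (fun i h1 h2 => hu i h1 (by push_cast; omega))).mono
    (P' := Inside d a 0 (k + 1 : ℕ) (k + 1) u) (by
      rintro c ⟨hc, hc'⟩
      refine ⟨?_, fun i hi => hc' i ?_⟩ <;> push_cast at * <;> omega)
  have r2 := (hF (-d) b v hd' (by simp [hvb]) (fun i h1 h2 => by
      rw [hvi i (by rintro rfl; simp at h1)]
      apply hu <;> rcases hd with rfl | rfl <;> push_cast <;> omega)).mono
    (P' := Inside d a 0 (k + 1 : ℕ) (k + 1) u) (by
      rintro c ⟨hc, hc'⟩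
      refine ⟨?_, fun i hi => ?_⟩
      · rcases hd with rfl | rfl <;> push_cast <;> omega
      · rw [hc' i, hvi i] <;> rcases hd with rfl | rfl <;> push_cast at hi <;> omega)
  have r3 := (hH d a v hd (by simp [← hb, hvb]) (fun i h1 h2 => by
      rw [hvi i (by rcases hd with rfl | rfl <;> omega)]
      exact hu i h1 (by push_cast; omega))).mono
    (P' := Inside d a 0 (k + 1 : ℕ) (k + 1) u) (by
      rintro c ⟨hc, hc'⟩
      refine ⟨?_, fun i hi => ?_⟩
      · push_cast; omega
      · rw [hc' i, hvi i] <;> rcases hd with rfl | rfl <;> push_cast at hi <;> omega)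
  have inA : ∀ q, Inside d a 0 (k + 1 : ℕ) (k + 1) u ⟨q, a, v⟩ := fun q =>
    ⟨by simp; omega, fun i hi => hvi i (by
      rcases hd with rfl | rfl <;> push_cast at hi <;> omega)⟩
  have inB : ∀ q (w : ℤ → Letter), (∀ i, i ≠ b → w i = u i) →
      Inside d a 0 (k + 1 : ℕ) (k + 1) u ⟨q, b, w⟩ := fun q w hw =>
    ⟨by rcases hd with rfl | rfl <;> simp [hb] <;> omega, fun i hi => hw i (by
      rcases hd with rfl | rfl <;> push_cast at hi <;> omega)⟩
  have e : b + -d * (k + 1) = a := by rw [hb]; ring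
  have e' : a + d * ((k + 1 : ℕ) + 1) = b + d := by rw [hb]; push_cast; ring
  rw [e] at r2
  rw [← hb] at r1 r3
  rw [e', show innerTime (k + 1) + 1 = ((((0 + 1 + 1) + innerTime k + 1 + 1) +
    (innerTime k + 1) + 1) + (innerTime k + 1)) by rw [innerTime]; ring]
  refine r1.trans (Run.head (step_filled_zero hd hub) (inB _ _ fun _ _ => rfl) (r2.trans ?_))
  refine Run.head (step_filled_ne_zero hd' (by rwa [hva])) (inA _) ?_
  rw [neg_neg]
  refine Run.head (step_hollow_move hd _ _) (inA _) (r3.trans ?_)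
  refine Run.head (step_hollow_one hd hvb) (inB _ _ hvi) ?_
  rw [hvu]
  exact Run.head (step_filled_move hd _ _) (inB _ _ fun _ _ => rfl) Run.refl

lemma hollowMove_succ {k : ℕ} (hF : FilledMove k) (hH : HollowMove k) : HollowMove (k + 1) := by
  intro d a u hd ha hu
  have hd' : -d = 1 ∨ -d = -1 := by omega
  set b : ℤ := a + d * ((k + 1 : ℕ) + 1) with hb
  set v : ℤ → Letter := Function.update u (a + d) 2 with hv
  have hu1 : u (a + d) = 0 := by
    apply hu <;> rcases hd with rfl | rfl <;> simp
  have hba : b ≠ a + d := by rcases hd with rfl | rfl <;> push_cast at hb <;> omega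
  have hvb : v b = u b := by simp [hv, hba]
  have hva : v (a + d) = 2 := by simp [hv]
  have hvu : Function.update v (a + d) 0 = u := by simp [hv, ← hu1]
  have hvi : ∀ i, i ≠ a + d → v i = u i := fun i hi => by simp [hv, hi]
  have e : a + d + d * (k + 1) = b := by rw [hb]; push_cast; ring
  have e' : b + -d * (k + 1) = a + d := by rw [← e]; ring
  have r1 := (hF d (a + d) v hd (by simp [hva]) (fun i h1 h2 => by
      rw [hvi i (by rintro rfl; simp at h1)]
      apply hu <;> rcases hd with rfl | rfl <;> push_cast <;> omega)).mono
    (P' := Inside d a 1 ((k + 1 : ℕ) + 1) (k + 1) u) (by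
      rintro c ⟨hc, hc'⟩
      refine ⟨?_, fun i hi => ?_⟩
      · rcases hd with rfl | rfl <;> push_cast <;> omega
      · rw [hc' i, hvi i] <;> rcases hd with rfl | rfl <;> push_cast at hi <;> omega)
  have r2 := (hH (-d) b v hd' (by rw [e', hva]; decide) (fun i h1 h2 => by
      rw [hvi i (by rcases hd with rfl | rfl <;> push_cast at hb <;> omega)]
      apply hu <;> rcases hd with rfl | rfl <;> push_cast at hb ⊢ <;> omega)).mono
    (P' := Inside d a 1 ((k + 1 : ℕ) + 1) (k + 1) u) (by
      rintro c ⟨hc, hc'⟩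
      refine ⟨?_, fun i hi => ?_⟩
      · rcases hd with rfl | rfl <;> push_cast at hb ⊢ <;> omega
      · rw [hc' i, hvi i] <;> rcases hd with rfl | rfl <;> push_cast at hi hb <;> omega)
  have r3 := (hH d (a + d) u hd (by rwa [e]) (fun i h1 h2 => by
      apply hu <;> rcases hd with rfl | rfl <;> push_cast <;> omega)).mono
    (P' := Inside d a 1 ((k + 1 : ℕ) + 1) (k + 1) u) (by
      rintro c ⟨hc, hc'⟩
      refine ⟨?_, fun i hi => hc' i ?_⟩ <;> rcases hd with rfl | rfl <;> push_cast at * <;> omega)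
  have inA : ∀ q (w : ℤ → Letter), (∀ i, i ≠ a + d → w i = u i) →
      Inside d a 1 ((k + 1 : ℕ) + 1) (k + 1) u ⟨q, a + d, w⟩ := fun q w hw =>
    ⟨by rcases hd with rfl | rfl <;> simp <;> omega, fun i hi => hw i (by
      rcases hd with rfl | rfl <;> push_cast at hi <;> omega)⟩
  have inB : ∀ q, Inside d a 1 ((k + 1 : ℕ) + 1) (k + 1) u ⟨q, b, v⟩ := fun q =>
    ⟨by rcases hd with rfl | rfl <;> simp [hb] <;> omega, fun i hi => hvi i (by
      rcases hd with rfl | rfl <;> push_cast at hi <;> omega)⟩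
  rw [e] at r1 r3
  rw [e'] at r2
  rw [show innerTime (k + 1) = (((innerTime k + 1 + 1) + innerTime k + 1 + 1) +
    (innerTime k + 1)) + 1 by rw [innerTime]; ring]
  refine Run.head (step_hollow_zero hd hu1) (inA _ _ fun _ _ => rfl) (r1.trans ?_)
  refine Run.head (step_filled_ne_zero hd (by rwa [hvb])) (inB _) ?_
  refine Run.head (step_hollow_move hd' _ _) (inB _) (r2.trans ?_)
  refine Run.head (step_hollow_two hd' hva) (inA _ _ hvi) ?_
  rw [hvu, neg_neg]
  exact Run.head (step_hollow_move hd _ _) (inA _ _ fun _ _ => rfl) r3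

lemma filledMove_and_hollowMove (k : ℕ) : FilledMove k ∧ HollowMove k := by
  induction k with
  | zero =>
    refine ⟨fun d a u hd _ _ => ?_, fun d a u _ _ _ => ?_⟩
    · simpa [innerTime] using Run.head (P := Inside d a 0 0 0 u) (step_filled_move hd a u)
        ⟨by simp, fun _ _ => rfl⟩ Run.refl
    · simpa [innerTime] using Run.refl
  | succ k ih => exact ⟨filledMove_succ ih.1 ih.2, hollowMove_succ ih.1 ih.2⟩

lemma hollowMove_full {k : ℕ} {d a : ℤ} {u : ℤ → Letter} (hd : d = 1 ∨ d = -1)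
    (ha : u (a + d * (k + 1)) ≠ 0)
    (hu : ∀ i, 1 ≤ d * (i - a) → d * (i - a) ≤ k → u i = 0) :
    step^[smartTime k] ⟨hollow d 1, a, u⟩ = ⟨hollow d 0, a + d * (k + 1), u⟩ ∧
      ∀ t, 1 ≤ t → t ≤ smartTime k →
        Inside d a 1 (k + 1) k u (step^[t] ⟨hollow d 1, a, u⟩) := by
  have h := (filledMove_and_hollowMove k).2 d a u hd ha hu
  rw [smartTime_eq]
  refine ⟨by rw [Function.iterate_succ_apply, step_hollow_move hd, h.1], fun t h1 h2 => ?_⟩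
  obtain ⟨s, rfl⟩ := Nat.exists_eq_add_of_le' h1
  rw [Function.iterate_succ_apply, step_hollow_move hd]
  refine h.of_le ⟨?_, fun _ _ => rfl⟩ (by omega)
  rcases hd with rfl | rfl <;> simp

lemma toWord_of_iterate_step {x : ℤ → TSym SQ Letter} {n : ℕ} {q q' : SQ} {p p' : ℤ}
    {u : ℤ → Letter} (hx : x = toWord ⟨q, p, u⟩) (hp : p ≠ p')
    (h : step^[n] ⟨q, p, u⟩ = ⟨q', p', u⟩) :
    (∀ i, i ≠ p → i ≠ p' → (stepZ smartStep)^[n] x i = x i) ∧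
      (stepZ smartStep)^[n] x p = Sum.inl (u p) ∧
      (stepZ smartStep)^[n] x p' = Sum.inr (q', u p') := by
  subst hx
  rw [iterate_stepZ_toWord, h]
  exact ⟨fun i h1 h2 => by simp [toWord, h1, h2], by simp [toWord, hp], by simp [toWord]⟩

end HeadConf

open HeadConf

/-- **Proposition (basic moves of SMART).**  Let `T` be the moving-head action of the SMART
machine and `f(k) = 3^(k+1) − 2`.  For every `k ≥ 0`, `s_* ∈ {0,1,2}`, `s_+ ∈ {1,2}`, the
four moves `M_▶(k), M_◀(k), M_▷(k), M_◁(k)` hold, with the stated restrictions on the head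
positions and on the cell holding `s_+`. -/
theorem smart_basic_moves (k : ℕ) (sStar sPlus : Letter) (hPlus : sPlus ≠ 0) :
    -- M_▶(k)
    ((∀ x : ℤ → TSym SQ Letter, AtMostOneHeadZ x →
      x 0 = Sum.inr ((.rf, 1), sPlus) →
      (∀ i : ℤ, 1 ≤ i → i ≤ (k : ℤ) → x i = Sum.inl 0) →
      x ((k : ℤ) + 1) = Sum.inl sStar →
      (∀ i : ℤ, i ≠ 0 → i ≠ (k : ℤ) + 1 →
        (stepZ smartStep)^[smartTime k] x i = x i) ∧
      (stepZ smartStep)^[smartTime k] x 0 = Sum.inl sPlus ∧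
      (stepZ smartStep)^[smartTime k] x ((k : ℤ) + 1) = Sum.inr ((.rf, 0), sStar) ∧
      (∀ t : ℕ, t < smartTime k → ∀ i : ℤ,
        (((stepZ smartStep)^[t] x) i).isRight = true → 0 ≤ i ∧ i ≤ (k : ℤ)) ∧
      (∀ t : ℕ, t ≤ smartTime k → tapeLetter (((stepZ smartStep)^[t] x) 0) = sPlus))) ∧
    -- M_◀(k)
    ((∀ x : ℤ → TSym SQ Letter, AtMostOneHeadZ x →
      x 0 = Sum.inl sStar →
      (∀ i : ℤ, 1 ≤ i → i ≤ (k : ℤ) → x i = Sum.inl 0) →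
      x ((k : ℤ) + 1) = Sum.inr ((.lf, 1), sPlus) →
      (∀ i : ℤ, i ≠ 0 → i ≠ (k : ℤ) + 1 →
        (stepZ smartStep)^[smartTime k] x i = x i) ∧
      (stepZ smartStep)^[smartTime k] x 0 = Sum.inr ((.lf, 0), sStar) ∧
      (stepZ smartStep)^[smartTime k] x ((k : ℤ) + 1) = Sum.inl sPlus ∧
      (∀ t : ℕ, t < smartTime k → ∀ i : ℤ,
        (((stepZ smartStep)^[t] x) i).isRight = true → 1 ≤ i ∧ i ≤ (k : ℤ) + 1) ∧
      (∀ t : ℕ, t ≤ smartTime k →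
        tapeLetter (((stepZ smartStep)^[t] x) ((k : ℤ) + 1)) = sPlus))) ∧
    -- M_▷(k)
    ((∀ x : ℤ → TSym SQ Letter, AtMostOneHeadZ x →
      x 0 = Sum.inr ((.rh, 1), sStar) →
      (∀ i : ℤ, 1 ≤ i → i ≤ (k : ℤ) → x i = Sum.inl 0) →
      x ((k : ℤ) + 1) = Sum.inl sPlus →
      (∀ i : ℤ, i ≠ 0 → i ≠ (k : ℤ) + 1 →
        (stepZ smartStep)^[smartTime k] x i = x i) ∧
      (stepZ smartStep)^[smartTime k] x 0 = Sum.inl sStar ∧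
      (stepZ smartStep)^[smartTime k] x ((k : ℤ) + 1) = Sum.inr ((.rh, 0), sPlus) ∧
      (∀ t : ℕ, 1 ≤ t → t ≤ smartTime k → ∀ i : ℤ,
        (((stepZ smartStep)^[t] x) i).isRight = true → 1 ≤ i ∧ i ≤ (k : ℤ) + 1) ∧
      (∀ t : ℕ, t ≤ smartTime k →
        tapeLetter (((stepZ smartStep)^[t] x) ((k : ℤ) + 1)) = sPlus))) ∧
    -- M_◁(k)
    ((∀ x : ℤ → TSym SQ Letter, AtMostOneHeadZ x →
      x 0 = Sum.inl sPlus →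
      (∀ i : ℤ, 1 ≤ i → i ≤ (k : ℤ) → x i = Sum.inl 0) →
      x ((k : ℤ) + 1) = Sum.inr ((.lh, 1), sStar) →
      (∀ i : ℤ, i ≠ 0 → i ≠ (k : ℤ) + 1 →
        (stepZ smartStep)^[smartTime k] x i = x i) ∧
      (stepZ smartStep)^[smartTime k] x 0 = Sum.inr ((.lh, 0), sPlus) ∧
      (stepZ smartStep)^[smartTime k] x ((k : ℤ) + 1) = Sum.inl sStar ∧
      (∀ t : ℕ, 1 ≤ t → t ≤ smartTime k → ∀ i : ℤ,
        (((stepZ smartStep)^[t] x) i).isRight = true → 0 ≤ i ∧ i ≤ (k : ℤ)) ∧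
      (∀ t : ℕ, t ≤ smartTime k → tapeLetter (((stepZ smartStep)^[t] x) 0) = sPlus))) := by
  have one : (1 : ℤ) = 1 ∨ (1 : ℤ) = -1 := by simp
  have neg : (-1 : ℤ) = 1 ∨ (-1 : ℤ) = -1 := by simp
  refine ⟨fun x hx h0 hz h1 => ?_, fun x hx h0 hz h1 => ?_, fun x hx h0 hz h1 => ?_,
    fun x hx h0 hz h1 => ?_⟩
  · have hw := eq_toWord hx (q := filled 1 1) h0
    set u : ℤ → Letter := fun i => tapeLetter (x i) with hu
    have u0 : u 0 = sPlus := by simp [hu, h0, tapeLetter]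
    have u1 : u (k + 1) = sStar := by simp [hu, h1, tapeLetter]
    have hz' : ∀ i : ℤ, 1 ≤ i → i ≤ k → u i = 0 := fun i hi hi' => by
      simp [hu, hz i hi hi', tapeLetter]
    have r := (filledMove_and_hollowMove k).1 1 0 u one (by rwa [u0])
      (fun i hi hi' => hz' i (by omega) (by omega))
    rw [← smartTime_eq] at r
    rw [show (0 : ℤ) + 1 * (k + 1) = k + 1 by ring] at r
    obtain ⟨c1, c2, c3⟩ := toWord_of_iterate_step hw (by omega) r.1
    refine ⟨c1, by rw [c2, u0], by rw [c3, u1]; rfl, fun t ht i hi => ?_, fun t ht => ?_⟩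
    · rw [hw, iterate_stepZ_toWord, isRight_toWord] at hi
      have := (r.2 t ht).1
      omega
    · rw [hw, iterate_stepZ_toWord, tapeLetter_toWord, ← u0]
      rcases ht.lt_or_eq with ht | rfl
      · exact (r.2 t ht).2 _ (by omega)
      · rw [r.1]
  · have hw := eq_toWord hx (q := filled (-1) 1) h1
    set u : ℤ → Letter := fun i => tapeLetter (x i) with hu
    have u0 : u 0 = sStar := by simp [hu, h0, tapeLetter]
    have u1 : u (k + 1) = sPlus := by simp [hu, h1, tapeLetter]
    have hz' : ∀ i : ℤ, 1 ≤ i → i ≤ k → u i = 0 := fun i hi hi' => by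
      simp [hu, hz i hi hi', tapeLetter]
    have r := (filledMove_and_hollowMove k).1 (-1) (k + 1) u neg (by rwa [u1])
      (fun i hi hi' => hz' i (by omega) (by omega))
    rw [← smartTime_eq] at r
    rw [show (k + 1 : ℤ) + -1 * (k + 1) = 0 by ring] at r
    obtain ⟨c1, c2, c3⟩ := toWord_of_iterate_step hw (by omega) r.1
    refine ⟨fun i hi hi' => c1 i hi' hi, by rw [c3, u0]; rfl, by rw [c2, u1],
      fun t ht i hi => ?_, fun t ht => ?_⟩
    · rw [hw, iterate_stepZ_toWord, isRight_toWord] at hi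
      have := (r.2 t ht).1
      omega
    · rw [hw, iterate_stepZ_toWord, tapeLetter_toWord, ← u1]
      rcases ht.lt_or_eq with ht | rfl
      · exact (r.2 t ht).2 _ (by omega)
      · rw [r.1]
  · have hw := eq_toWord hx (q := hollow 1 1) h0
    set u : ℤ → Letter := fun i => tapeLetter (x i) with hu
    have u0 : u 0 = sStar := by simp [hu, h0, tapeLetter]
    have u1 : u (k + 1) = sPlus := by simp [hu, h1, tapeLetter]
    have hz' : ∀ i : ℤ, 1 ≤ i → i ≤ k → u i = 0 := fun i hi hi' => by
      simp [hu, hz i hi hi', tapeLetter]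
    have r := hollowMove_full (d := 1) (a := 0) (u := u) one
      (by convert hPlus; rw [← u1]; congr 1; ring)
      (fun i hi hi' => hz' i (by omega) (by omega))
    rw [show (0 : ℤ) + 1 * (k + 1) = k + 1 by ring] at r
    obtain ⟨c1, c2, c3⟩ := toWord_of_iterate_step hw (by omega) r.1
    refine ⟨c1, by rw [c2, u0], by rw [c3, u1]; rfl, fun t ht ht' i hi => ?_, fun t ht => ?_⟩
    · rw [hw, iterate_stepZ_toWord, isRight_toWord] at hi
      have := (r.2 t ht ht').1
      omega
    · rw [hw, iterate_stepZ_toWord, tapeLetter_toWord, ← u1]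
      rcases t.eq_zero_or_pos with rfl | ht'
      · rfl
      · exact (r.2 t ht' ht).2 _ (by omega)
  · have hw := eq_toWord hx (q := hollow (-1) 1) h1
    set u : ℤ → Letter := fun i => tapeLetter (x i) with hu
    have u0 : u 0 = sPlus := by simp [hu, h0, tapeLetter]
    have u1 : u (k + 1) = sStar := by simp [hu, h1, tapeLetter]
    have hz' : ∀ i : ℤ, 1 ≤ i → i ≤ k → u i = 0 := fun i hi hi' => by
      simp [hu, hz i hi hi', tapeLetter]
    have r := hollowMove_full (d := (-1)) (a := (k + 1)) (u := u) neg
      (by convert hPlus; rw [← u0]; congr 1; ring)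
      (fun i hi hi' => hz' i (by omega) (by omega))
    rw [show (k + 1 : ℤ) + -1 * (k + 1) = 0 by ring] at r
    obtain ⟨c1, c2, c3⟩ := toWord_of_iterate_step hw (by omega) r.1
    refine ⟨fun i hi hi' => c1 i hi' hi, by rw [c3, u0]; rfl, by rw [c2, u1],
      fun t ht ht' i hi => ?_, fun t ht => ?_⟩
    · rw [hw, iterate_stepZ_toWord, isRight_toWord] at hi
      have := (r.2 t ht ht').1
      omega
    · rw [hw, iterate_stepZ_toWord, tapeLetter_toWord, ← u0]
      rcases t.eq_zero_or_pos with rfl | ht'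
      · rfl
      · exact (r.2 t ht' ht).2 _ (by omega)
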